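/- arXiv:2506.22152 — 3 statements merged into one kernel-verified Lean document; each statement's English description precedes it below -/
import Mathlib

section
/- Let E and H be infinite-dimensional real Hilbert spaces with continuous injections E ↪ H ↪ E′, where the injection E ↪ H has norm at most 1 and E is identified with its image in H; write ‖·‖ for the E-norm and |·| for the H-norm. For c⃗ = (c_1,…,c_m) with c_j > 0, let S_{c⃗} := {u⃗ = (u_1,…,u_m) ∈ E^m : |u_j|² = c_j, j = 1,…,m}, and for w⃗ ∈ S_{c⃗} let T_{w⃗}S_{c⃗} := {φ⃗ ∈ E^m : (φ_j, w_j)_H = 0 for all j}. Let u⃗ ∈ B_{c⃗} ⊂ S_{c⃗}, let U be a neighborhood of u⃗ in S_{c⃗} with B_{c⃗} ∩ closure(U) closed in S_{c⃗}, and let V be a Lipschitz mapping on closure(U) with V(w⃗) ∈ T_{w⃗}S_{c⃗} for all w⃗ ∈ closure(U), satisfying lim_{s↘0} s^{-1} dist(w⃗ + sV(w⃗), B_{c⃗}) = 0 for all w⃗ ∈ closure(U) ∩ B_{c⃗}. Then there exist r = r(u⃗) > 0 and a curve η(·,u⃗) : [0,r) → S_{c⃗} with ∂η/∂t (t,u⃗)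 = V(η(t,u⃗)) for all t ∈ [0,r), η(0,u⃗) = u⃗, and η(t,u⃗) ∈ B_{c⃗} for all t ∈ [0,r). -/
open MeasureTheory Metric Set Filter Function
open scoped RealInnerProductSpace

noncomputable section

section GelfandTriple

variable {E H : Type*}
  [NormedAddCommGroup E] [InnerProductSpace ℝ E]
  [NormedAddCommGroup H] [InnerProductSpace ℝ H]
  {m : ℕ}

/-- The product-of-spheres constraint set
`S_{c⃗} = {u⃗ ∈ E^m : |u_j|² = c_j}`, where `|·|` is the `H`-norm realized
through the injection `jEH : E ↪ H`. -/
def sphereProd (jEH : E →L[ℝ] H) (c : Fin m → ℝ) : Set (Fin m → E) :=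
  {u | ∀ i, ⟪jEH (u i), jEH (u i)⟫ = c i}

/-- `v⃗` belongs to the tangent space `T_{w⃗}S_{c⃗}`:
`(v_j, w_j)_H = 0` for all `j`. -/
def tangentAt (jEH : E →L[ℝ] H) (w v : Fin m → E) : Prop :=
  ∀ i, ⟪jEH (v i), jEH (w i)⟫ = 0

end GelfandTriple

/-- A closed set of time-indexed states in which every state before the final time `r` can be
advanced, at speed at most `M`, contains a state at time `r`. -/
theorem exists_mk_mem_of_forall_lt_exists_advance {X : Type*} [MetricSpace X] [CompleteSpace X]
    {A : Set (ℝ × X)} (hA : IsClosed A) (hne : A.Nonempty) {M r : ℝ} (hM : 0 < M)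
    (hr : ∀ p ∈ A, p.1 ≤ r)
    (hadv : ∀ p ∈ A, p.1 < r → ∃ q ∈ A, p.1 < q.1 ∧ dist p.2 q.2 ≤ M * (q.1 - p.1)) :
    ∃ y, (r, y) ∈ A := by
  let R : A → A → Prop := fun p q => dist p.1.2 q.1.2 ≤ M * (q.1.1 - p.1.1)
  have htrans : ∀ {p q s : A}, R p q → R q s → R p s := by
    intro p q s hpq hqs
    have := dist_triangle p.1.2 q.1.2 s.1.2
    simp only [R] at *
    linarith
  have hchain : ∀ C : Set A, IsChain R C → ∃ ub, ∀ p ∈ C, R p ub := by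
    intro C hC
    rcases C.eq_empty_or_nonempty with rfl | hCne
    · exact ⟨⟨hne.some, hne.some_mem⟩, by simp⟩
    have hdist : ∀ p ∈ C, ∀ q ∈ C, dist p.1.2 q.1.2 ≤ M * |q.1.1 - p.1.1| := by
      intro p hp q hq
      by_cases hpq : p = q
      · simp [hpq]
      rcases hC hp hq hpq with h | h
      · exact h.trans (by gcongr; exact le_abs_self _)
      · rw [dist_comm, abs_sub_comm]
        exact le_trans h (by gcongr; exact le_abs_self _)
    let f : A → ℝ := fun p => p.1.1
    have hbdd : BddAbove (f '' C) := ⟨r, by rintro _ ⟨p, -, rfl⟩; exact hr _ p.2⟩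
    obtain ⟨t, htmono, htlim, htmem⟩ := exists_seq_tendsto_sSup (hCne.image f) hbdd
    set T := sSup (f '' C)
    choose a haC hat using htmem
    have hle : ∀ p ∈ C, p.1.1 ≤ T := fun p hp => le_csSup hbdd ⟨p, hp, rfl⟩
    have hcauchy : CauchySeq fun n => (a n).1.2 := by
      refine cauchySeq_of_le_tendsto_0' (fun n => M * (T - t n)) (fun n k hnk => ?_) ?_
      · refine (hdist _ (haC n) _ (haC k)).trans ?_
        change M * |f (a k) - f (a n)| ≤ _
        have h1 : f (a k) ≤ T := hle _ (haC k)
        rw [hat] at h1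
        rw [hat, hat, abs_of_nonneg (sub_nonneg.2 (htmono hnk))]
        gcongr
      · simpa using (htlim.const_sub T).const_mul M
    obtain ⟨y, hy⟩ := cauchySeq_tendsto_of_complete hcauchy
    have hfa : Tendsto (fun n => (a n).1.1) atTop (nhds T) := by
      refine htlim.congr fun n => (hat n).symm
    have hTy : (T, y) ∈ A :=
      hA.mem_of_tendsto (hfa.prodMk_nhds hy) (Eventually.of_forall fun n => (a n).2)
    refine ⟨⟨(T, y), hTy⟩, fun p hp => ?_⟩
    have hlim := le_of_tendsto_of_tendsto' (tendsto_const_nhds.dist hy)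
      ((hfa.sub tendsto_const_nhds).abs.const_mul M) fun n => hdist p hp _ (haC n)
    rwa [abs_of_nonneg (sub_nonneg.2 (hle p hp))] at hlim
  obtain ⟨p, hp⟩ := exists_maximal_of_chains_bounded hchain htrans
  rcases (hr _ p.2).lt_or_eq with hlt | heq
  · obtain ⟨q, hqA, hpq, hq⟩ := hadv _ p.2 hlt
    have h1 : dist q.2 p.1.2 ≤ M * (p.1.1 - q.1) := hp ⟨q, hqA⟩ hq
    have h2 : M * (p.1.1 - q.1) < 0 := mul_neg_of_pos_of_neg hM (by linarith)
    linarith [dist_nonneg (x := q.2) (y := p.1.2)]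
  · exact ⟨p.1.2, heq ▸ p.2⟩

section Invariance

variable {X : Type*} [NormedAddCommGroup X] [NormedSpace ℝ X]

/-- A curve and a direction subtangent to `B` can be followed simultaneously, up to an error
`ε * h`, for some arbitrarily short time `h`. -/
theorem exists_euler_step {B : Set X} (hB : B.Nonempty) {y v x' : X}
    (hv : Tendsto (fun s : ℝ => s⁻¹ * infDist (y + s • v) B) (nhdsWithin 0 (Ioi 0)) (nhds 0))
    {x : ℝ → X} {t r : ℝ} (ht : 0 ≤ t) (htr : t < r) (hx : HasDerivWithinAt x x' (Icc 0 r) t)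
    {ε : ℝ} (hε : 0 < ε) :
    ∃ h : ℝ, 0 < h ∧ t + h ≤ r ∧ ‖x (t + h) - x t - h • x'‖ ≤ ε * h ∧
      ∃ z ∈ B, ‖z - (y + h • v)‖ ≤ ε * h := by
  have hshift : Tendsto (fun h : ℝ => t + h) (nhdsWithin 0 (Ioi 0)) (nhdsWithin t (Icc 0 r)) := by
    refine tendsto_nhdsWithin_iff.2 ⟨?_, ?_⟩
    · have : Tendsto (fun h : ℝ => t + h) (nhds 0) (nhds (t + 0)) :=
        (continuous_const.add continuous_id).tendsto 0
      rw [add_zero] at this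
      exact this.mono_left nhdsWithin_le_nhds
    · filter_upwards [Ioc_mem_nhdsGT (sub_pos.2 htr)] with h hh
      exact ⟨by linarith [hh.1], by linarith [hh.2]⟩
  have hderiv := hshift.eventually ((hasDerivWithinAt_iff_isLittleO.1 hx).bound hε)
  obtain ⟨h, hx_h, hv_h, hpos, hle⟩ := (hderiv.and ((hv.eventually (gt_mem_nhds hε)).and
    (Ioc_mem_nhdsGT (sub_pos.2 htr)))).exists
  refine ⟨h, hpos, by linarith, ?_, ?_⟩
  · simpa [abs_of_pos hpos] using hx_h
  · have hlt : infDist (y + h • v) B < ε * h := by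
      rwa [inv_mul_lt_iff₀ hpos, mul_comm] at hv_h
    obtain ⟨z, hzB, hz⟩ := (infDist_lt_iff hB).1 hlt
    exact ⟨z, hzB, by rw [← dist_eq_norm, dist_comm]; exact hz.le⟩

/-- **Nagumo–Brézis invariance**: an integral curve of a Lipschitz vector field that starts in a
locally closed set to which the field is subtangent stays in that set for a short time. -/
theorem mem_of_hasDerivWithinAt_of_subtangent [CompleteSpace X]
    {B : Set X} {u : X} (hu : u ∈ B) {δ : ℝ} (hδ : 0 ≤ δ) (hclosed : IsClosed (B ∩ closedBall u δ))
    {W : X → X} {K : NNReal} (hW : LipschitzOnWith K W (closedBall u δ)) {L : ℝ}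
    (hL : ∀ y ∈ closedBall u δ, ‖W y‖ ≤ L)
    (hsub : ∀ y ∈ B ∩ closedBall u δ,
      Tendsto (fun s : ℝ => s⁻¹ * infDist (y + s • W y) B) (nhdsWithin 0 (Ioi 0)) (nhds 0))
    {x : ℝ → X} {r : ℝ} (hr : 0 ≤ r) (hx0 : x 0 = u)
    (hx : ∀ t ∈ Icc 0 r, HasDerivWithinAt x (W (x t)) (Icc 0 r) t)
    (hxmem : ∀ t ∈ Icc 0 r, x t ∈ closedBall u δ)
    (hLr : (L + 1) * r ≤ δ) (hKr : K * r ≤ 1 / 2) :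
    x r ∈ B := by
  have hL0 : 0 ≤ L := (norm_nonneg _).trans (hL u (mem_closedBall_self hδ))
  have hxcont : ContinuousOn x (Icc 0 r) := fun t ht => (hx t ht).continuousWithinAt
  have happrox : ∀ ε : ℝ, 0 < ε → ε ≤ 1 →
      ∃ y ∈ B ∩ closedBall u δ, dist y (x r) ≤ 4 * ε * r := by
    intro ε hε hε1
    let S : Set (ℝ × X) := Icc 0 r ×ˢ (B ∩ closedBall u δ)
    let A : Set (ℝ × X) :=
      {p ∈ {p ∈ S | dist p.2 (x p.1) ≤ 4 * ε * p.1} | dist p.2 u ≤ (L + 1) * p.1}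
    have hA : IsClosed A := by
      refine IsClosed.isClosed_le (IsClosed.isClosed_le (isClosed_Icc.prod hclosed) ?_ ?_) ?_ ?_
      · exact continuous_dist.comp_continuousOn
          (continuousOn_snd.prodMk (hxcont.comp continuousOn_fst fun p hp => hp.1))
      all_goals fun_prop
    have hAne : A.Nonempty :=
      ⟨(0, u), ⟨⟨⟨le_rfl, hr⟩, hu, mem_closedBall_self hδ⟩, by simp [hx0]⟩, by simp⟩
    suffices hadv : ∀ p ∈ A, p.1 < r →
        ∃ q ∈ A, p.1 < q.1 ∧ dist p.2 q.2 ≤ (L + 1) * (q.1 - p.1) by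
      obtain ⟨y, hy⟩ := exists_mk_mem_of_forall_lt_exists_advance hA hAne
        (by linarith) (fun p hp => hp.1.1.1.2) hadv
      exact ⟨y, hy.1.1.2, hy.1.2⟩
    rintro ⟨t, y⟩ ⟨⟨⟨⟨ht0, -⟩, hyF⟩, hyx⟩, hyu⟩ htr
    simp only at ht0 hyF hyx hyu htr
    have htI : t ∈ Icc 0 r := ⟨ht0, htr.le⟩
    obtain ⟨h, hpos, hthr, hxh, z, hzB, hz⟩ :=
      exists_euler_step ⟨u, hu⟩ (hsub y hyF) ht0 htr (hx t htI) hε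
    have hyz : dist y z ≤ (L + 1) * h := by
      have h1 : ‖h • W y‖ ≤ h * L := by
        rw [norm_smul, Real.norm_of_nonneg hpos.le]
        exact mul_le_mul_of_nonneg_left (hL y hyF.2) hpos.le
      have h2 : z - y = (z - (y + h • W y)) + h • W y := by abel
      rw [dist_comm, dist_eq_norm, h2]
      have h3 : ε * h ≤ 1 * h := mul_le_mul_of_nonneg_right hε1 hpos.le
      linarith [norm_add_le (z - (y + h • W y)) (h • W y)]
    have hzu : dist z u ≤ (L + 1) * (t + h) := by
      linarith [dist_triangle z y u, dist_comm y z]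
    have hzδ : z ∈ closedBall u δ := by
      refine mem_closedBall.2 (hzu.trans (le_trans ?_ hLr))
      gcongr
    have hzx : dist z (x (t + h)) ≤ 4 * ε * (t + h) := by
      have hWd : ‖h • (W y - W (x t))‖ ≤ h * (2 * ε) := by
        rw [norm_smul, Real.norm_of_nonneg hpos.le, ← dist_eq_norm]
        gcongr
        calc dist (W y) (W (x t)) ≤ K * dist y (x t) := hW.dist_le_mul _ hyF.2 _ (hxmem t htI)
          _ ≤ K * (4 * ε * r) := by gcongr; exact hyx.trans (by gcongr)
          _ = 4 * ε * (K * r) := by ring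
          _ ≤ 4 * ε * (1 / 2) := by gcongr
          _ = 2 * ε := by ring
      have hsplit : z - x (t + h) = (z - (y + h • W y)) + ((y - x t) + h • (W y - W (x t)))
          - (x (t + h) - x t - h • W (x t)) := by
        rw [smul_sub]; abel
      rw [dist_eq_norm] at hyx ⊢
      rw [hsplit]
      have h1 := norm_sub_le ((z - (y + h • W y)) + ((y - x t) + h • (W y - W (x t))))
        (x (t + h) - x t - h • W (x t))
      have h2 := norm_add_le (z - (y + h • W y)) ((y - x t) + h • (W y - W (x t)))
      have h3 := norm_add_le (y - x t) (h • (W y - W (x t)))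
      linarith
    exact ⟨(t + h, z), ⟨⟨⟨⟨by positivity, hthr⟩, hzB, hzδ⟩, hzx⟩, hzu⟩, by simpa using hpos,
      by simpa using hyz⟩
  refine (hclosed.closure_subset (Metric.mem_closure_iff.2 fun η hη => ?_)).1
  obtain ⟨y, hy, hdist⟩ := happrox (min 1 (η / (4 * r + 1))) (by positivity) (min_le_left _ _)
  refine ⟨y, hy, ?_⟩
  rw [dist_comm]
  calc dist y (x r) ≤ 4 * min 1 (η / (4 * r + 1)) * r := hdist
    _ ≤ 4 * (η / (4 * r + 1)) * r := by gcongr; exact min_le_right _ _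
    _ = η * (4 * r / (4 * r + 1)) := by ring
    _ < η * 1 := by gcongr; rw [div_lt_one (by positivity)]; linarith
    _ = η := mul_one η

/-- Local existence of integral curves of a Lipschitz vector field which remain in a locally
closed set to which the field is subtangent. -/
theorem exists_integralCurve_mem_of_subtangent [CompleteSpace X]
    {B : Set X} {u : X} (hu : u ∈ B) {δ : ℝ} (hδ : 0 < δ) (hclosed : IsClosed (B ∩ closedBall u δ))
    {W : X → X} {K : NNReal} (hW : LipschitzOnWith K W (closedBall u δ))
    (hsub : ∀ y ∈ B ∩ closedBall u δ,
      Tendsto (fun s : ℝ => s⁻¹ * infDist (y + s • W y) B) (nhdsWithin 0 (Ioi 0)) (nhds 0)) :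
    ∃ r : ℝ, 0 < r ∧ ∃ x : ℝ → X, x 0 = u ∧
      ∀ t ∈ Icc 0 r, HasDerivWithinAt x (W (x t)) (Icc 0 r) t ∧ x t ∈ B ∩ closedBall u δ := by
  set L : ℝ := ‖W u‖ + K * δ with hLdef
  have hL : ∀ y ∈ closedBall u δ, ‖W y‖ ≤ L := by
    intro y hy
    have h1 : ‖W y - W u‖ ≤ K * δ := by
      rw [← dist_eq_norm]
      refine (hW.dist_le_mul _ hy _ (mem_closedBall_self hδ.le)).trans ?_
      gcongr
      exact hy
    have h2 := norm_sub_norm_le (W y) (W u)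
    linarith
  have hL0 : 0 ≤ L := by positivity
  set T : ℝ := min (δ / (L + 1)) (1 / (2 * (K + 1)))
  have hT : 0 < T := by positivity
  have hLT : (L + 1) * T ≤ δ := by
    rw [mul_comm, ← le_div_iff₀ (by positivity)]
    exact min_le_left _ _
  have hKT : K * T ≤ 1 / 2 := by
    have h1 : T * (2 * (K + 1)) ≤ 1 := (le_div_iff₀ (by positivity)).1 (min_le_right _ _)
    linarith
  have hpl : IsPicardLindelof (fun _ => W) (⟨0, le_rfl, hT.le⟩ : Icc (0 : ℝ) T) u
      ⟨δ, hδ.le⟩ 0 ⟨L, hL0⟩ K :=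
    IsPicardLindelof.of_time_independent hL hW (by
      simp only [sub_zero, sub_self, NNReal.coe_zero, max_eq_left hT.le]
      change L * T ≤ δ
      linarith)
  obtain ⟨x, hx0, hx⟩ := hpl.exists_eq_forall_mem_Icc_hasDerivWithinAt₀
  have hcont : ContinuousWithinAt x (Icc 0 T) 0 := (hx 0 ⟨le_rfl, hT.le⟩).continuousWithinAt
  have hnear : {t | x t ∈ closedBall u δ} ∈ nhdsWithin 0 (Icc 0 T) :=
    hcont (by rw [hx0]; exact closedBall_mem_nhds u hδ)
  obtain ⟨ρ, hρ, hball⟩ := Metric.mem_nhdsWithin_iff.1 hnear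
  have hrT : min T (ρ / 2) ≤ T := min_le_left _ _
  have hmem : ∀ t ∈ Icc 0 (min T (ρ / 2)), x t ∈ closedBall u δ := by
    intro t ht
    refine hball ⟨?_, ht.1, ht.2.trans hrT⟩
    rw [mem_ball, Real.dist_eq, sub_zero, abs_of_nonneg ht.1]
    linarith [ht.2.trans (min_le_right T (ρ / 2))]
  refine ⟨min T (ρ / 2), by positivity, x, hx0, fun t ht =>
    ⟨(hx t ⟨ht.1, ht.2.trans hrT⟩).mono (Icc_subset_Icc_right hrT), ?_, hmem t ht⟩⟩
  have htT : t ≤ T := ht.2.trans hrT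
  refine mem_of_hasDerivWithinAt_of_subtangent hu hδ.le hclosed hW hL hsub ht.1 hx0
    (fun s hs => (hx s ⟨hs.1, hs.2.trans htT⟩).mono (Icc_subset_Icc_right htT))
    (fun s hs => hmem s ⟨hs.1, hs.2.trans ht.2⟩) (le_trans (by gcongr) hLT)
    (le_trans (by gcongr) hKT)

end Invariance

section Retraction

variable {E H : Type*}
  [NormedAddCommGroup E] [InnerProductSpace ℝ E]
  [NormedAddCommGroup H] [InnerProductSpace ℝ H]
  {m : ℕ}

/-- The radial retraction onto the product of spheres `sphereProd jEH c`. -/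
def sphereRetraction (jEH : E →L[ℝ] H) (c : Fin m → ℝ) (w : Fin m → E) : Fin m → E :=
  fun i => (√(c i) / ‖jEH (w i)‖) • w i

theorem norm_eq_sqrt_of_mem_sphereProd {jEH : E →L[ℝ] H} {c : Fin m → ℝ} {w : Fin m → E}
    (hw : w ∈ sphereProd jEH c) (i : Fin m) : ‖jEH (w i)‖ = √(c i) := by
  rw [← hw i, real_inner_self_eq_norm_sq, Real.sqrt_sq (norm_nonneg _)]

theorem map_ne_zero_of_mem_sphereProd {jEH : E →L[ℝ] H} {c : Fin m → ℝ} (hc : ∀ i, 0 < c i)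
    {w : Fin m → E} (hw : w ∈ sphereProd jEH c) (i : Fin m) : jEH (w i) ≠ 0 := by
  rw [← norm_pos_iff, norm_eq_sqrt_of_mem_sphereProd hw]
  exact Real.sqrt_pos.2 (hc i)

theorem sphereRetraction_eq_self {jEH : E →L[ℝ] H} {c : Fin m → ℝ} (hc : ∀ i, 0 < c i)
    {w : Fin m → E} (hw : w ∈ sphereProd jEH c) : sphereRetraction jEH c w = w := by
  funext i
  rw [sphereRetraction, norm_eq_sqrt_of_mem_sphereProd hw,
    div_self (Real.sqrt_pos.2 (hc i)).ne', one_smul]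

theorem sphereRetraction_mem {jEH : E →L[ℝ] H} {c : Fin m → ℝ} (hc : ∀ i, 0 < c i)
    {w : Fin m → E} (hw : ∀ i, jEH (w i) ≠ 0) : sphereRetraction jEH c w ∈ sphereProd jEH c := by
  intro i
  have h : ‖jEH (w i)‖ ≠ 0 := norm_ne_zero_iff.2 (hw i)
  rw [real_inner_self_eq_norm_sq, sphereRetraction, map_smul, norm_smul, norm_div, norm_norm,
    div_mul_cancel₀ _ h, Real.norm_of_nonneg (Real.sqrt_nonneg _), Real.sq_sqrt (hc i).le]

theorem contDiffAt_sphereRetraction {jEH : E →L[ℝ] H} {c : Fin m → ℝ} {w : Fin m → E}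
    (hw : ∀ i, jEH (w i) ≠ 0) : ContDiffAt ℝ 1 (sphereRetraction jEH c) w := by
  refine contDiffAt_pi.2 fun i => ?_
  have hi : ContDiffAt ℝ 1 (fun v : Fin m → E => v i) w := (contDiff_apply ℝ E i).contDiffAt
  have hj : ContDiffAt ℝ 1 (fun v : Fin m → E => jEH (v i)) w := jEH.contDiff.contDiffAt.comp w hi
  exact (contDiffAt_const.div (hj.norm ℝ (hw i)) (norm_ne_zero_iff.2 (hw i))).smul hi

end Retraction

/-- **Proposition 3.2** (Brézis–Martin on a product manifold). In a Gelfand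
triple `E ↪ H ↪ E'` of infinite-dimensional real Hilbert spaces (the injection
`E ↪ H` having norm at most `1`), let `B_{c⃗} ⊆ S_{c⃗}`, let `u⃗ ∈ B_{c⃗}`, let `U`
be a neighborhood of `u⃗` in `S_{c⃗}` with `B_{c⃗} ∩ closure U` closed, and let
`V` be a Lipschitz tangent field on `closure U` with
`lim_{s↘0} s⁻¹ dist(w⃗ + sV(w⃗), B_{c⃗}) = 0` on `closure U ∩ B_{c⃗}`. Then the
flow of `V` starting at `u⃗` exists on some `[0,r)` and stays in `B_{c⃗}`. -/
theorem brezis_martin_product_manifold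
    {E H : Type*}
    [NormedAddCommGroup E] [InnerProductSpace ℝ E] [CompleteSpace E]
    [NormedAddCommGroup H] [InnerProductSpace ℝ H] [CompleteSpace H]
    (hEinf : ¬ FiniteDimensional ℝ E) (hHinf : ¬ FiniteDimensional ℝ H)
    {m : ℕ} (hm : 0 < m)
    (jEH : E →L[ℝ] H) (hj_inj : Function.Injective jEH) (hj_norm : ‖jEH‖ ≤ 1)
    (jHD : H →L[ℝ] (E →L[ℝ] ℝ)) (hjD_inj : Function.Injective jHD)
    (hcompat : ∀ (h : H) (e : E), jHD h e = ⟪h, jEH e⟫)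
    (c : Fin m → ℝ) (hc : ∀ i, 0 < c i)
    (Bc : Set (Fin m → E)) (hBc : Bc ⊆ sphereProd jEH c)
    (u : Fin m → E) (hu : u ∈ Bc)
    (U : Set (Fin m → E)) (hUsub : U ⊆ sphereProd jEH c)
    (hUnbhd : U ∈ nhdsWithin u (sphereProd jEH c))
    (hclosed : IsClosed (Bc ∩ closure U))
    (V : (Fin m → E) → (Fin m → E))
    (hVlip : ∃ K : NNReal, LipschitzOnWith K V (closure U))
    (hVtan : ∀ w ∈ closure U, tangentAt jEH w (V w))
    (hlim : ∀ w ∈ closure U ∩ Bc,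
      Tendsto (fun s : ℝ => s⁻¹ * Metric.infDist (w + s • V w) Bc)
        (nhdsWithin 0 (Set.Ioi 0)) (nhds 0)) :
    ∃ r : ℝ, 0 < r ∧ ∃ η : ℝ → (Fin m → E),
      η 0 = u ∧
      ∀ t ∈ Set.Ico (0 : ℝ) r,
        HasDerivWithinAt η (V (η t)) (Set.Ico (0 : ℝ) r) t ∧ η t ∈ Bc := by
  obtain ⟨K, hK⟩ := hVlip
  have huS := hBc hu
  have hune := map_ne_zero_of_mem_sphereProd hc huS
  have hPdiff : ContDiffAt ℝ 1 (sphereRetraction jEH c) u := contDiffAt_sphereRetraction hune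
  obtain ⟨K', N, hN, hPlip⟩ := hPdiff.exists_lipschitzOnWith
  have hne : ∀ᶠ w in nhds u, ∀ i, jEH (w i) ≠ 0 :=
    eventually_all.2 fun i =>
      (jEH.continuous.comp (continuous_apply i)).continuousAt.eventually_ne (hune i)
  have hPU : ∀ᶠ w in nhds u, sphereRetraction jEH c w ∈ U := by
    have htend : Tendsto (sphereRetraction jEH c) (nhds u)
        (nhdsWithin u (sphereProd jEH c)) := by
      refine tendsto_nhdsWithin_iff.2 ⟨?_, hne.mono fun w hw => sphereRetraction_mem hc hw⟩
      simpa [ContinuousAt, sphereRetraction_eq_self hc huS] using hPdiff.continuousAt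
    exact htend.eventually hUnbhd
  obtain ⟨δ, hδ, hball⟩ :=
    Metric.nhds_basis_closedBall.mem_iff.1 (inter_mem hN hPU)
  have hself : ∀ w ∈ Bc, sphereRetraction jEH c w = w := fun w hw =>
    sphereRetraction_eq_self hc (hBc hw)
  have hFU : ∀ w ∈ Bc ∩ closedBall u δ, w ∈ closure U := by
    intro w hw
    have h1 : sphereRetraction jEH c w ∈ U := (hball hw.2).2
    rw [hself w hw.1] at h1
    exact subset_closure h1
  have hFclosed : IsClosed (Bc ∩ closedBall u δ) := by
    have hF : Bc ∩ closedBall u δ = Bc ∩ closure U ∩ closedBall u δ := by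
      ext w
      exact ⟨fun hw => ⟨⟨hw.1, hFU w hw⟩, hw.2⟩, fun hw => ⟨hw.1.1, hw.2⟩⟩
    rw [hF]
    exact hclosed.inter isClosed_closedBall
  have hWlip : LipschitzOnWith (K * K') (V ∘ sphereRetraction jEH c) (closedBall u δ) :=
    hK.comp (hPlip.mono fun w hw => (hball hw).1) fun w hw => subset_closure (hball hw).2
  obtain ⟨r, hr, η, hη0, hη⟩ := exists_integralCurve_mem_of_subtangent hu hδ hFclosed hWlip
    fun w hw => by
      simpa only [Function.comp_apply, hself w hw.1] using hlim w ⟨hFU w hw, hw.1⟩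
  refine ⟨r, hr, η, hη0, fun t ht => ?_⟩
  obtain ⟨hderiv, hmem⟩ := hη t (Ico_subset_Icc_self ht)
  rw [Function.comp_apply, hself _ hmem.1] at hderiv
  exact ⟨hderiv.mono Ico_subset_Icc_self, hmem.1⟩
end
end

section
/- Under the Hilbert space setting E ↪ H ↪ E′ and the product-of-spheres constraint S_{c⃗}, let B_{c⃗} ⊂ S_{c⃗} be closed in S_{c⃗}, let V be a locally Lipschitz mapping with V(w⃗) ∈ T_{w⃗}S_{c⃗} for all w⃗ ∈ S_{c⃗}, and let η(t,·) : S_{c⃗} → S_{c⃗} be defined by ∂η/∂t(t,u⃗) = V(η(t,u⃗)), η(0,u⃗) = u⃗, with T_{u⃗} > 0 the maximal existence time for u⃗ ∈ S_{c⃗}. Let B* ⊂ S_{c⃗} be an open subset such that η(t,u⃗) ∈ B* for all u⃗ ∈ B* and 0 < t < T_{u⃗}. If lim_{s↘0} s^{-1} dist(u⃗ + sV(u⃗), B_{c⃗}) = 0 for every u⃗ ∈ B_{c⃗} ∩ B*, then η(t,u⃗) ∈ B_{c⃗} ∩ B* for every u⃗ ∈ B_{c⃗} ∩ B* and all 0 <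 t < T_{u⃗}. -/
open MeasureTheory Metric Set Filter Function
open scoped RealInnerProductSpace

noncomputable section

/-- In a closed set of time-space pairs with bounded times, there is a pair that cannot be continued
to a strictly later time at speed at most `M`. -/
theorem exists_time_maximal {F : Type*} [MetricSpace F] [CompleteSpace F]
    {A : Set (ℝ × F)} (hA : IsClosed A) (hne : A.Nonempty) (hbdd : BddAbove (Prod.fst '' A))
    {M : ℝ} (hM : 0 ≤ M) :
    ∃ p ∈ A, ∀ q ∈ A, p.1 ≤ q.1 → dist p.2 q.2 ≤ M * (q.1 - p.1) → q.1 ≤ p.1 := by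
  let r : A → A → Prop := fun p q => p.1.1 ≤ q.1.1 ∧ dist p.1.2 q.1.2 ≤ M * (q.1.1 - p.1.1)
  have hr_trans : ∀ {a b d : A}, r a b → r b d → r a d := by
    rintro a b d ⟨h1, h2⟩ ⟨h3, h4⟩
    exact ⟨h1.trans h3, by linarith [dist_triangle a.1.2 b.1.2 d.1.2]⟩
  obtain ⟨p, hp⟩ := exists_maximal_of_chains_bounded (r := r) (fun C hC => by
    rcases C.eq_empty_or_nonempty with rfl | hCne
    · exact ⟨⟨hne.some, hne.some_mem⟩, by simp⟩
    have hdist : ∀ a ∈ C, ∀ b ∈ C, dist a.1.2 b.1.2 ≤ M * |b.1.1 - a.1.1| := by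
      intro a ha b hb
      rcases eq_or_ne a b with rfl | hab
      · simp
      rcases hC ha hb hab with h | h
      · exact h.2.trans (mul_le_mul_of_nonneg_left (le_abs_self _) hM)
      · rw [dist_comm, abs_sub_comm]
        exact h.2.trans (mul_le_mul_of_nonneg_left (le_abs_self _) hM)
    let D : Set ℝ := (fun a : A => a.1.1) '' C
    have hDbdd : BddAbove D := hbdd.mono (by
      rintro _ ⟨a, -, rfl⟩
      exact ⟨a.1, a.2, rfl⟩)
    obtain ⟨t, -, ht, htD⟩ := exists_seq_tendsto_sSup (hCne.image _) hDbdd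
    choose a haC hat using htD
    have hcau : CauchySeq fun n => (a n).1.2 := by
      rw [Metric.cauchySeq_iff']
      intro ε hε
      obtain ⟨N, hN⟩ := Metric.cauchySeq_iff'.1 ht.cauchySeq (ε / (M + 1)) (by positivity)
      refine ⟨N, fun n hn => ?_⟩
      have h1 := hdist _ (haC n) _ (haC N)
      have h2 := hN n hn
      rw [Real.dist_eq, abs_sub_comm, lt_div_iff₀ (by positivity)] at h2
      simp only at hat
      rw [hat, hat] at h1
      nlinarith [abs_nonneg (t N - t n)]
    obtain ⟨x, hx⟩ := cauchySeq_tendsto_of_complete hcau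
    have hlim : Tendsto (fun n => (a n).1) atTop (nhds (sSup D, x)) := by
      have ht' : Tendsto (fun n => (a n).1.1) atTop (nhds (sSup D)) :=
        ht.congr fun n => (hat n).symm
      exact ht'.prodMk_nhds hx
    refine ⟨⟨(sSup D, x), hA.mem_of_tendsto hlim (Eventually.of_forall fun n => (a n).2)⟩, ?_⟩
    intro b hb
    have hbt : b.1.1 ≤ sSup D := le_csSup hDbdd ⟨b, hb, rfl⟩
    refine ⟨hbt, ?_⟩
    have h1 : dist b.1.2 x ≤ M * |sSup D - b.1.1| := by
      refine le_of_tendsto_of_tendsto' (tendsto_const_nhds.dist hx)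
        ((ht.sub_const b.1.1).abs.const_mul M) fun n => ?_
      rw [← hat n]
      exact hdist b hb _ (haC n)
    rwa [abs_of_nonneg (sub_nonneg.2 hbt)] at h1) hr_trans
  exact ⟨p.1, p.2, fun q hq h1 h2 => (hp ⟨q, hq⟩ ⟨h1, h2⟩).1⟩

/-- A locally Lipschitz map satisfies a uniform Lipschitz estimate between the points of a compact
set and the points of a tube around it; the tube may be taken inside a given neighbourhood. -/
theorem IsCompact.exists_tube_lipschitz {F G : Type*} [MetricSpace F] [MetricSpace G]
    {K O : Set F} (hK : IsCompact K) (hO : IsOpen O) (hKO : K ⊆ O) {V : F → G}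
    (hV : LocallyLipschitz V) :
    ∃ r > 0, ∃ L ≥ (0 : ℝ), ∀ y ∈ K, ∀ x, dist x y < r →
      x ∈ O ∧ dist (V x) (V y) ≤ L * dist x y := by
  refine hK.induction_on (p := fun s => ∃ r > 0, ∃ L ≥ (0 : ℝ), ∀ y ∈ s, ∀ x, dist x y < r →
    x ∈ O ∧ dist (V x) (V y) ≤ L * dist x y) ⟨1, one_pos, 0, le_rfl, by simp⟩ ?_ ?_ ?_
  · rintro s t hst ⟨r, hr, L, hL, h⟩
    exact ⟨r, hr, L, hL, fun y hy => h y (hst hy)⟩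
  · rintro s t ⟨r, hr, L, hL, h⟩ ⟨r', hr', L', hL', h'⟩
    refine ⟨min r r', lt_min hr hr', max L L', le_max_of_le_left hL, ?_⟩
    rintro y (hy | hy) x hx
    · obtain ⟨h1, h2⟩ := h y hy x (hx.trans_le (min_le_left _ _))
      exact ⟨h1, h2.trans (mul_le_mul_of_nonneg_right (le_max_left _ _) dist_nonneg)⟩
    · obtain ⟨h1, h2⟩ := h' y hy x (hx.trans_le (min_le_right _ _))
      exact ⟨h1, h2.trans (mul_le_mul_of_nonneg_right (le_max_right _ _) dist_nonneg)⟩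
  · intro y₀ hy₀
    obtain ⟨L, s, hs, hL⟩ := hV y₀
    obtain ⟨r, hr, hrs⟩ := Metric.mem_nhds_iff.1 (inter_mem hs (hO.mem_nhds (hKO hy₀)))
    refine ⟨ball y₀ (r / 2), mem_nhdsWithin_of_mem_nhds (ball_mem_nhds _ (by positivity)),
      r / 2, by positivity, L, L.2, fun y hy x hx => ?_⟩
    rw [mem_ball] at hy
    have hx' : x ∈ s ∩ O := hrs (by rw [mem_ball]; linarith [dist_triangle x y y₀])
    have hy' : y ∈ s ∩ O := hrs (by rw [mem_ball]; linarith)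
    exact ⟨hx'.2, hL.dist_le_mul x hx'.1 y hy'.1⟩

/-- A closed set satisfying the subtangent condition for a locally Lipschitz vector field `V` at its
points in an open set `O` is invariant along the integral curves of `V` that stay in `O`. -/
theorem mem_of_subtangent {F : Type*} [NormedAddCommGroup F] [NormedSpace ℝ F]
    [CompleteSpace F] {B O : Set F} (hB : IsClosed B) (hO : IsOpen O) {V : F → F}
    (hV : LocallyLipschitz V)
    (hlim : ∀ u ∈ B ∩ O, Tendsto (fun s : ℝ => s⁻¹ * infDist (u + s • V u) B)
      (nhdsWithin 0 (Ioi 0)) (nhds 0))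
    {γ : ℝ → F} {τ : ℝ} (hτ : 0 ≤ τ)
    (hγ : ∀ t ∈ Icc 0 τ, HasDerivWithinAt γ (V (γ t)) (Ici 0) t)
    (hγO : ∀ t ∈ Icc 0 τ, γ t ∈ O) (hγ0 : γ 0 ∈ B) : γ τ ∈ B := by
  have hγc : ContinuousOn γ (Icc 0 τ) := fun t ht =>
    (hγ t ht).continuousWithinAt.mono Icc_subset_Ici_self
  obtain ⟨r, hr, L, hL, htube⟩ := (isCompact_Icc.image_of_continuousOn hγc).exists_tube_lipschitz
    hO (by rintro _ ⟨t, ht, rfl⟩; exact hγO t ht) hV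
  obtain ⟨N, hN⟩ := isCompact_Icc.exists_bound_of_continuousOn
    (hV.continuous.comp_continuousOn hγc)
  have hN0 : 0 ≤ N := (norm_nonneg _).trans (hN 0 ⟨le_rfl, hτ⟩)
  rw [← hB.closure_eq, Metric.mem_closure_iff]
  intro δ' hδ'
  obtain ⟨δ, hδ, hδlt⟩ := exists_between (lt_min hδ' hr)
  obtain ⟨hδδ', hδr⟩ := lt_min_iff.1 hδlt
  set ε : ℝ := δ * Real.exp (-((L + 1) * τ)) with hε
  have hε0 : 0 < ε := by positivity
  set φ : ℝ → ℝ := fun t => ε * Real.exp ((L + 1) * t) with hφ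
  have hφτ : φ τ = δ := by
    simp only [hφ, hε]
    rw [mul_assoc, ← Real.exp_add]
    simp
  have hφmono : ∀ t ≤ τ, φ t ≤ δ := fun t ht => by
    rw [← hφτ]
    simp only [hφ]
    gcongr
  have hφε : ∀ t, 0 ≤ t → ε ≤ φ t := fun t ht =>
    le_mul_of_one_le_right hε0.le (Real.one_le_exp (by positivity))
  have hφstep : ∀ t s, φ t + s * ((L + 1) * φ t) ≤ φ (t + s) := fun t s => by
    have h := Real.add_one_le_exp ((L + 1) * s)
    have h' : φ (t + s) = φ t * Real.exp ((L + 1) * s) := by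
      change ε * _ = ε * _ * _
      rw [mul_add, Real.exp_add, mul_assoc ε]
    have h0 : 0 < φ t := by positivity
    rw [h']
    nlinarith
  let A : Set (ℝ × F) := (Icc 0 τ ×ˢ B) ∩ (fun p => dist p.2 (γ p.1) - φ p.1) ⁻¹' Iic 0
  have hAclosed : IsClosed A := by
    refine ContinuousOn.preimage_isClosed_of_isClosed ?_ (isClosed_Icc.prod hB) isClosed_Iic
    have h1 : ContinuousOn (fun p : ℝ × F => γ p.1) (Icc 0 τ ×ˢ B) :=
      hγc.comp continuousOn_fst fun p hp => hp.1
    have h2 : Continuous fun p : ℝ × F => φ p.1 := by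
      simp only [hφ]
      fun_prop
    exact (continuous_dist.comp_continuousOn (continuousOn_snd.prodMk h1)).sub h2.continuousOn
  have hAne : A.Nonempty := ⟨(0, γ 0), ⟨⟨⟨le_rfl, hτ⟩, hγ0⟩, by
    simpa using hε0.le.trans (hφε 0 le_rfl)⟩⟩
  have hAbdd : BddAbove (Prod.fst '' A) := ⟨τ, by
    rintro _ ⟨p, hp, rfl⟩
    exact hp.1.1.2⟩
  obtain ⟨⟨t, x⟩, ⟨⟨⟨ht0, htτ⟩, hxB⟩, hxφ⟩, hmax⟩ :=
    exists_time_maximal hAclosed hAne hAbdd (M := N + L * r + ε) (by positivity)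
  simp only [mem_preimage, mem_Iic, sub_nonpos] at ht0 htτ hxB hxφ hmax
  rcases htτ.eq_or_lt with rfl | htlt
  · exact ⟨x, hxB, by rw [dist_comm]; linarith⟩
  exfalso
  have hxr : dist x (γ t) < r := (hxφ.trans (hφmono t htτ)).trans_lt hδr
  obtain ⟨hxO, hxV⟩ := htube _ ⟨t, ⟨ht0, htτ⟩, rfl⟩ x hxr
  have ev1 : ∀ᶠ s : ℝ in nhdsWithin 0 (Ioi 0), s⁻¹ * infDist (x + s • V x) B < ε / 2 :=
    (hlim x ⟨hxB, hxO⟩).eventually_lt_const (by positivity)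
  have hshift : Tendsto (fun s : ℝ => t + s) (nhdsWithin 0 (Ioi 0)) (nhdsWithin t (Ici 0)) := by
    refine tendsto_nhdsWithin_iff.2 ⟨?_, ?_⟩
    · have h : Tendsto (fun s : ℝ => t + s) (nhds 0) (nhds (t + 0)) :=
        (continuous_const.add continuous_id).tendsto 0
      rw [add_zero] at h
      exact h.mono_left nhdsWithin_le_nhds
    · filter_upwards [self_mem_nhdsWithin] with s hs
      exact add_nonneg ht0 (le_of_lt hs)
  have ev2 := hshift.eventually
    ((hasDerivWithinAt_iff_isLittleO.1 (hγ t ⟨ht0, htτ⟩)).def (half_pos hε0))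
  have ev3 : ∀ᶠ s : ℝ in nhdsWithin 0 (Ioi 0), s < τ - t :=
    mem_nhdsWithin_of_mem_nhds (Iio_mem_nhds (sub_pos.2 htlt))
  obtain ⟨s, hs1, hs2, hs3, hs0⟩ := (ev1.and (ev2.and (ev3.and self_mem_nhdsWithin))).exists
  rw [add_sub_cancel_left, Real.norm_of_nonneg hs0.le] at hs2
  rw [inv_mul_lt_iff₀ hs0, infDist_lt_iff ⟨_, hγ0⟩] at hs1
  obtain ⟨y, hyB, hy⟩ := hs1
  rw [dist_eq_norm] at hy
  have hyφ : dist y (γ (t + s)) ≤ φ (t + s) := by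
    have hdecomp : y - γ (t + s) = -(x + s • V x - y) + (x - γ t) + s • (V x - V (γ t))
        - (γ (t + s) - γ t - s • V (γ t)) := by
      rw [smul_sub]
      abel
    have h1 : ‖s • (V x - V (γ t))‖ ≤ s * (L * φ t) := by
      rw [norm_smul, Real.norm_of_nonneg hs0.le, ← dist_eq_norm]
      gcongr
      exact hxV.trans (by gcongr)
    have h2 : s * ε ≤ s * φ t := by
      gcongr
      exact hφε t ht0
    rw [dist_eq_norm] at hxφ ⊢
    rw [hdecomp]
    refine (norm_sub_le _ _).trans ?_
    have h3 := norm_add_le (-(x + s • V x - y) + (x - γ t)) (s • (V x - V (γ t)))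
    have h4 := norm_add_le (-(x + s • V x - y)) (x - γ t)
    rw [norm_neg] at h4
    have h5 := hφstep t s
    linarith
  have hxy : dist x y ≤ (N + L * r + ε) * (t + s - t) := by
    have hVx : ‖V x‖ ≤ N + L * r := by
      have h1 := norm_le_norm_add_norm_sub' (V x) (V (γ t))
      have h2 := hN t ⟨ht0, htτ⟩
      have h3 : L * dist x (γ t) ≤ L * r := by gcongr
      rw [← dist_eq_norm] at h1
      simp only [comp_apply] at h2
      linarith
    have hdecomp : x - y = (x + s • V x - y) - s • V x := by abel
    have h1 : ‖s • V x‖ ≤ s * (N + L * r) := by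
      rw [norm_smul, Real.norm_of_nonneg hs0.le]
      gcongr
    rw [dist_eq_norm, hdecomp]
    refine (norm_sub_le _ _).trans ?_
    nlinarith
  have hmem : ((t + s, y) : ℝ × F) ∈ A :=
    ⟨⟨⟨by positivity, by linarith⟩, hyB⟩, by simpa using hyφ⟩
  have := hmax _ hmem (by simp [hs0.le]) hxy
  simp only at this
  linarith

/-- **Corollary 3.3** (flow invariance). Let `B_{c⃗} ⊆ S_{c⃗}` be closed in
`S_{c⃗}` and `V` a locally Lipschitz tangent field on `S_{c⃗}` with flow `η`
(with maximal existence time `T u⃗`). Let `B* ⊆ S_{c⃗}` be open in `S_{c⃗}` and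
positively invariant under `η`. If
`lim_{s↘0} s⁻¹ dist(u⃗ + sV(u⃗), B_{c⃗}) = 0` for all `u⃗ ∈ B_{c⃗} ∩ B*`, then
`η(t,u⃗) ∈ B_{c⃗} ∩ B*` for all `u⃗ ∈ B_{c⃗} ∩ B*` and all `0 < t < T u⃗`. -/
theorem flow_invariance_of_Bc
    {E H : Type*}
    [NormedAddCommGroup E] [InnerProductSpace ℝ E] [CompleteSpace E]
    [NormedAddCommGroup H] [InnerProductSpace ℝ H] [CompleteSpace H]
    (hEinf : ¬ FiniteDimensional ℝ E) (hHinf : ¬ FiniteDimensional ℝ H)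
    {m : ℕ} (hm : 0 < m)
    (jEH : E →L[ℝ] H) (hj_inj : Function.Injective jEH) (hj_norm : ‖jEH‖ ≤ 1)
    (jHD : H →L[ℝ] (E →L[ℝ] ℝ)) (hjD_inj : Function.Injective jHD)
    (hcompat : ∀ (h : H) (e : E), jHD h e = ⟪h, jEH e⟫)
    (c : Fin m → ℝ) (hc : ∀ i, 0 < c i)
    (Bc : Set (Fin m → E)) (hBc : Bc ⊆ sphereProd jEH c)
    (hBcClosed : closure Bc ∩ sphereProd jEH c ⊆ Bc)
    (V : (Fin m → E) → (Fin m → E)) (hVlip : LocallyLipschitz V)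
    (hVtan : ∀ w ∈ sphereProd jEH c, tangentAt jEH w (V w))
    (T : (Fin m → E) → ENNReal) (hTpos : ∀ u ∈ sphereProd jEH c, 0 < T u)
    (η : ℝ → (Fin m → E) → (Fin m → E))
    (hη0 : ∀ u ∈ sphereProd jEH c, η 0 u = u)
    (hηode : ∀ u ∈ sphereProd jEH c, ∀ t : ℝ, 0 ≤ t → ENNReal.ofReal t < T u →
      HasDerivWithinAt (fun s => η s u) (V (η t u)) (Set.Ici (0 : ℝ)) t ∧
        η t u ∈ sphereProd jEH c)
    (hTmax : ∀ u ∈ sphereProd jEH c, ∀ T' : ENNReal, T u < T' →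
      ∀ γ : ℝ → (Fin m → E), γ 0 = u →
        (∀ t : ℝ, 0 ≤ t → ENNReal.ofReal t < T' →
          HasDerivWithinAt γ (V (γ t)) (Set.Ici (0 : ℝ)) t) → False)
    (Bstar : Set (Fin m → E)) (hBstarSub : Bstar ⊆ sphereProd jEH c)
    (hBstarOpen : ∃ O : Set (Fin m → E), IsOpen O ∧ Bstar = O ∩ sphereProd jEH c)
    (hBstarInv : ∀ u ∈ Bstar, ∀ t : ℝ, 0 < t → ENNReal.ofReal t < T u →
      η t u ∈ Bstar)
    (hlim : ∀ u ∈ Bc ∩ Bstar,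
      Tendsto (fun s : ℝ => s⁻¹ * Metric.infDist (u + s • V u) Bc)
        (nhdsWithin 0 (Set.Ioi 0)) (nhds 0)) :
    ∀ u ∈ Bc ∩ Bstar, ∀ t : ℝ, 0 < t → ENNReal.ofReal t < T u →
      η t u ∈ Bc ∩ Bstar := by
  rintro u ⟨huB, huS⟩ t ht htT
  refine ⟨?_, hBstarInv u huS t ht htT⟩
  have hu := hBc huB
  have hSclosed : IsClosed (sphereProd jEH c) := by
    simp only [sphereProd, ofPred_forall]
    exact isClosed_iInter fun i => isClosed_eq (by fun_prop) continuous_const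
  have hBclosed : IsClosed Bc := isClosed_of_closure_subset fun x hx =>
    hBcClosed ⟨hx, closure_minimal hBc hSclosed hx⟩
  obtain ⟨O, hO, rfl⟩ := hBstarOpen
  have hT : ∀ s ∈ Icc 0 t, ENNReal.ofReal s < T u := fun s hs =>
    (ENNReal.ofReal_le_ofReal hs.2).trans_lt htT
  refine mem_of_subtangent (γ := fun s => η s u) hBclosed hO hVlip
    (fun x hx => hlim x ⟨hx.1, hx.2, hBc hx.1⟩) ht.le
    (fun s hs => (hηode u hu s hs.1 (hT s hs)).1) (fun s hs => ?_) (by simpa [hη0 u hu] using huB)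
  rcases hs.1.eq_or_lt with rfl | hs0
  · simpa [hη0 u hu] using huS.1
  · exact (hBstarInv u huS s hs0 (hT s hs)).1
end
end

section
/- Under the Hilbert space setting E ↪ H ↪ E′ and the product-of-spheres constraint S_{c⃗}, let B_{c⃗} = B̃ ∩ S_{c⃗} where B̃ ⊂ E^m is closed, convex in E^m, and satisfies (k_1w_1, …, k_mw_m) ∈ B̃ for all (k_1,…,k_m) ∈ (0,1]^m and all (w_1,…,w_m) ∈ B̃. For u⃗ ∈ B_{c⃗}, if V(u⃗) ∈ T_{u⃗}S_{c⃗} has the form V(u⃗) = G(u⃗) − u⃗ with G(u⃗) ∈ B̃, then lim_{s↘0} s^{-1} dist(u⃗ + sV(u⃗), B_{c⃗}) = 0. -/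
open MeasureTheory Metric Set Filter Function
open scoped RealInnerProductSpace

noncomputable section

/-- Pythagoras for a step `s • v` orthogonal to `x`. -/
lemma inner_self_add_smul_of_inner_eq_zero {H : Type*} [NormedAddCommGroup H]
    [InnerProductSpace ℝ H] {x v : H} (h : ⟪v, x⟫ = 0) (s : ℝ) :
    ⟪x + s • v, x + s • v⟫ = ⟪x, x⟫ + s ^ 2 * ⟪v, v⟫ := by
  have h' : ⟪x, v⟫ = 0 := by rw [real_inner_comm]; exact h
  simp only [inner_add_left, inner_add_right, real_inner_smul_left, real_inner_smul_right, h, h']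
  ring

/-- The factor `√(c / (c + a))` differs from `1` by at most `a / c`. -/
lemma one_sub_sqrt_div_le {c a : ℝ} (hc : 0 < c) (ha : 0 ≤ a) :
    1 - √(c / (c + a)) ≤ a / c := by
  have hca : 0 < c + a := by linarith
  have h0 : 0 ≤ c / (c + a) := by positivity
  have h1 : c / (c + a) ≤ 1 := by rw [div_le_one hca]; linarith
  have h2 : c / (c + a) ≤ √(c / (c + a)) := Real.le_sqrt_of_sq_le (by nlinarith)
  have h3 : 1 - c / (c + a) = a / (c + a) := by field_simp; ring
  have h4 : a / (c + a) ≤ a / c := by gcongr; linarith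
  linarith

/-- Rescaling a tangential step back to the product of spheres costs a distance of second
order. -/
lemma infDist_add_smul_inter_sphereProd_le {E H : Type*}
    [NormedAddCommGroup E] [InnerProductSpace ℝ E]
    [NormedAddCommGroup H] [InnerProductSpace ℝ H] {m : ℕ}
    (jEH : E →L[ℝ] H) (c : Fin m → ℝ) (hc : ∀ i, 0 < c i) (B : Set (Fin m → E))
    (hB : ∀ k : Fin m → ℝ, (∀ i, 0 < k i ∧ k i ≤ 1) → ∀ w ∈ B, (fun i => k i • w i) ∈ B)
    {u V : Fin m → E} (hu : u ∈ sphereProd jEH c) (hV : tangentAt jEH u V)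
    {s : ℝ} (hs0 : 0 ≤ s) (hs1 : s ≤ 1) (hmem : u + s • V ∈ B) :
    infDist (u + s • V) (B ∩ sphereProd jEH c) ≤
      s ^ 2 * ((∑ i, ⟪jEH (V i), jEH (V i)⟫ / c i) * (‖u‖ + ‖V‖)) := by
  have hn : ∀ i, 0 ≤ ⟪jEH (V i), jEH (V i)⟫ := fun i => real_inner_self_nonneg
  have ha : ∀ i, 0 ≤ s ^ 2 * ⟪jEH (V i), jEH (V i)⟫ := fun i => mul_nonneg (sq_nonneg s) (hn i)
  have hca : ∀ i, 0 < c i + s ^ 2 * ⟪jEH (V i), jEH (V i)⟫ := fun i => by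
    linarith [hc i, ha i]
  set k : Fin m → ℝ := fun i => √(c i / (c i + s ^ 2 * ⟪jEH (V i), jEH (V i)⟫))
  have hk0 : ∀ i, 0 < k i := fun i => Real.sqrt_pos.2 (div_pos (hc i) (hca i))
  have hk1 : ∀ i, k i ≤ 1 := fun i => by
    refine Real.sqrt_le_one.2 ((div_le_one (hca i)).2 ?_)
    linarith [ha i]
  have hsphere : (fun i => k i • (u + s • V) i) ∈ sphereProd jEH c := fun i => by
    have hsq : k i * k i = c i / (c i + s ^ 2 * ⟪jEH (V i), jEH (V i)⟫) :=
      Real.mul_self_sqrt (div_pos (hc i) (hca i)).le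
    simp only [Pi.add_apply, Pi.smul_apply, map_smul, map_add, real_inner_smul_left,
      real_inner_smul_right]
    rw [inner_self_add_smul_of_inner_eq_zero (hV i), hu i, ← mul_assoc, hsq,
      div_mul_cancel₀ _ (hca i).ne']
  have hS : 0 ≤ ∑ i, ⟪jEH (V i), jEH (V i)⟫ / c i :=
    Finset.sum_nonneg fun i _ => div_nonneg (hn i) (hc i).le
  have hstep : ‖u + s • V‖ ≤ ‖u‖ + ‖V‖ := by
    refine (norm_add_le _ _).trans ?_
    rw [norm_smul, Real.norm_of_nonneg hs0]
    gcongr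
    exact mul_le_of_le_one_left (norm_nonneg _) hs1
  have hBS : (fun i => k i • (u + s • V) i) ∈ B ∩ sphereProd jEH c :=
    ⟨hB k (fun i => ⟨hk0 i, hk1 i⟩) _ hmem, hsphere⟩
  refine (infDist_le_dist_of_mem hBS).trans ?_
  refine (dist_pi_le_iff (by positivity)).2 fun i => ?_
  have hdiff : (u + s • V) i - k i • (u + s • V) i = (1 - k i) • (u + s • V) i := by
    rw [sub_smul, one_smul]
  have hfactor : 1 - k i ≤ s ^ 2 * ∑ i, ⟪jEH (V i), jEH (V i)⟫ / c i := by
    refine (one_sub_sqrt_div_le (hc i) (ha i)).trans ?_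
    rw [mul_div_assoc]
    gcongr
    exact Finset.single_le_sum
      (f := fun i => ⟪jEH (V i), jEH (V i)⟫ / c i)
      (fun j _ => div_nonneg (hn j) (hc j).le) (Finset.mem_univ i)
  rw [dist_eq_norm, hdiff, norm_smul, Real.norm_of_nonneg (sub_nonneg.2 (hk1 i)), ← mul_assoc]
  exact mul_le_mul hfactor ((norm_le_pi_norm _ i).trans hstep) (norm_nonneg _) (by positivity)

/-- **Lemma 3.4.** Let `B_{c⃗} = B̃ ∩ S_{c⃗}`, where `B̃ ⊆ E^m` is closed, convex
and stable under componentwise scalings by factors in `(0,1]`. If `u⃗ ∈ B_{c⃗}`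
and `V(u⃗) = G(u⃗) - u⃗ ∈ T_{u⃗}S_{c⃗}` with `G(u⃗) ∈ B̃`, then
`lim_{s↘0} s⁻¹ dist(u⃗ + sV(u⃗), B_{c⃗}) = 0`. -/
theorem convex_invariance_dist_limit
    {E H : Type*}
    [NormedAddCommGroup E] [InnerProductSpace ℝ E] [CompleteSpace E]
    [NormedAddCommGroup H] [InnerProductSpace ℝ H] [CompleteSpace H]
    (hEinf : ¬ FiniteDimensional ℝ E) (hHinf : ¬ FiniteDimensional ℝ H)
    {m : ℕ} (hm : 0 < m)
    (jEH : E →L[ℝ] H) (hj_inj : Function.Injective jEH) (hj_norm : ‖jEH‖ ≤ 1)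
    (jHD : H →L[ℝ] (E →L[ℝ] ℝ)) (hjD_inj : Function.Injective jHD)
    (hcompat : ∀ (h : H) (e : E), jHD h e = ⟪h, jEH e⟫)
    (c : Fin m → ℝ) (hc : ∀ i, 0 < c i)
    (Btil : Set (Fin m → E)) (hBtilClosed : IsClosed Btil)
    (hBtilConvex : Convex ℝ Btil)
    (hBtilCone : ∀ k : Fin m → ℝ, (∀ i, 0 < k i ∧ k i ≤ 1) →
      ∀ w ∈ Btil, (fun i => k i • w i) ∈ Btil)
    (u : Fin m → E) (hu : u ∈ Btil ∩ sphereProd jEH c)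
    (G V : Fin m → E) (hG : G ∈ Btil) (hV : V = G - u)
    (hVtan : tangentAt jEH u V) :
    Tendsto (fun s : ℝ => s⁻¹ * Metric.infDist (u + s • V) (Btil ∩ sphereProd jEH c))
      (nhdsWithin 0 (Set.Ioi 0)) (nhds 0) := by
  set C : ℝ := (∑ i, ⟪jEH (V i), jEH (V i)⟫ / c i) * (‖u‖ + ‖V‖)
  have hlim : Tendsto (fun s : ℝ => s * C) (nhdsWithin 0 (Set.Ioi 0)) (nhds 0) :=
    ((continuous_mul_const C).tendsto' 0 0 (zero_mul C)).mono_left nhdsWithin_le_nhds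
  refine tendsto_of_tendsto_of_tendsto_of_le_of_le' tendsto_const_nhds hlim ?_ ?_
  · filter_upwards [self_mem_nhdsWithin] with s hs
    exact mul_nonneg (inv_nonneg.2 (le_of_lt hs)) infDist_nonneg
  · filter_upwards [Ioc_mem_nhdsGT (zero_lt_one' ℝ)] with s hs
    have hmem : u + s • V ∈ Btil := by
      rw [hV]
      exact hBtilConvex.add_smul_sub_mem hu.1 hG ⟨hs.1.le, hs.2⟩
    rw [inv_mul_le_iff₀ hs.1, ← mul_assoc, ← sq]
    exact infDist_add_smul_inter_sphereProd_le jEH c hc Btil hBtilCone hu.2 hVtan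
      hs.1.le hs.2 hmem
end
end
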